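/- Let 0 < R < 1 and ε > 0, and let c_τ : [R,1] → (0,∞), τ ∈ (−ε,ε), be a family of C^{1,1} functions, each satisfying the Herglotz condition and the countable conjugacy condition, such that (τ,r) ↦ c_τ(r) is continuous, differentiable in τ, and (τ,r) ↦ ∂_τ c_τ(r) is continuous. If lsp'(c_τ) = lsp'(c_0) for all τ ∈ (−ε,ε), then c_τ = c_0 for all τ ∈ (−ε,ε). -/

import Mathlib

/-- `c` is `C^{1,1}` on `[R,1]`: differentiable with Lipschitz derivative. -/
def IsC11On (c : ℝ → ℝ) (R : ℝ) : Prop :=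
  ∃ c' : ℝ → ℝ, ∃ K : NNReal,
    (∀ r ∈ Set.Icc R 1, HasDerivWithinAt c (c' r) (Set.Icc R 1) r) ∧
    LipschitzOnWith K c' (Set.Icc R 1)

/-- The Herglotz condition: `d/dr (r / c r) > 0` on `[R,1]`. -/
def HerglotzCond (c : ℝ → ℝ) (R : ℝ) : Prop :=
  ∀ r ∈ Set.Icc R 1, 0 < derivWithin (fun s => s / c s) (Set.Icc R 1) r

/-- Half length `L(r)` of the maximal geodesic of radius `r`. -/
noncomputable def Lfun (c : ℝ → ℝ) (r : ℝ) : ℝ :=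
  ∫ s in r..1, (c s)⁻¹ * (Real.sqrt (1 - (r * c s / (s * c r)) ^ 2))⁻¹

/-- Half of the angular distance `α(r)` between the endpoints of the maximal geodesic
of radius `r`. -/
noncomputable def alphaFun (c : ℝ → ℝ) (r : ℝ) : ℝ :=
  ∫ s in r..1, (r * c s) / (c r * s ^ 2) * (Real.sqrt (1 - (r * c s / (s * c r)) ^ 2))⁻¹

/-- The length spectrum (without inner reflections): lengths `2 n L(r)` of periodic
broken rays, where the broken ray of radius `r` closes up after `n` reflections and
`m` windings, `n, m` coprime positive integers with `n α(r) = m π`. -/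
noncomputable def lsp (c : ℝ → ℝ) (R : ℝ) : Set ℝ :=
  {ℓ | ∃ r ∈ Set.Ioo R 1, ∃ n m : ℕ, 0 < n ∧ 0 < m ∧ Nat.Coprime n m ∧
        (n : ℝ) * alphaFun c r = (m : ℝ) * Real.pi ∧ ℓ = 2 * (n : ℝ) * Lfun c r}

/-- The angular advance `β(z)` of a geodesic segment from the inner boundary `r = R`
to the outer boundary `r = 1` with angular momentum `z`. -/
noncomputable def betaFun (c : ℝ → ℝ) (R : ℝ) (z : ℝ) : ℝ :=
  ∫ r in R..1, (z * c r / r ^ 2) * (Real.sqrt (1 - (z * c r / r) ^ 2))⁻¹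

/-- The travel time `T(z)` of a geodesic segment from the inner boundary to the outer
boundary with angular momentum `z`. -/
noncomputable def Tfun (c : ℝ → ℝ) (R : ℝ) (z : ℝ) : ℝ :=
  ∫ r in R..1, (c r)⁻¹ * (Real.sqrt (1 - (z * c r / r) ^ 2))⁻¹

/-- The length spectrum including broken rays reflecting at the inner boundary. -/
noncomputable def lsp' (c : ℝ → ℝ) (R : ℝ) : Set ℝ :=
  lsp c R ∪
    {ℓ | ∃ z : ℝ, 0 < z ∧ z < R / c R ∧ ∃ n m : ℕ, 0 < n ∧ 0 < m ∧ Nat.Coprime n m ∧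
      (n : ℝ) * betaFun c R z = (m : ℝ) * Real.pi ∧ ℓ = 2 * (n : ℝ) * Tfun c R z}

open MeasureTheory Set Filter Topology

/-- The inverse square root singularity is integrable. -/
lemma intble_inv_sqrt_abs (r0 a b : ℝ) :
    IntervalIntegrable (fun s => (√|s - r0|)⁻¹) volume a b := by
  have h0 : ∀ a b : ℝ, IntervalIntegrable (fun s : ℝ => (√|s|)⁻¹) volume a b := by
    have hpos : ∀ b : ℝ, 0 ≤ b → IntervalIntegrable (fun s : ℝ => (√|s|)⁻¹) volume 0 b := by
      intro b hb
      have h := intervalIntegral.intervalIntegrable_rpow' (a := 0) (b := b) (r := -(1/2))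
        (by norm_num)
      refine h.congr ?_
      intro x hx
      rw [uIoc_of_le hb] at hx
      have hx0 : 0 < x := hx.1
      simp only
      rw [Real.rpow_neg hx0.le, ← Real.sqrt_eq_rpow, abs_of_pos hx0]
    have hall : ∀ b : ℝ, IntervalIntegrable (fun s : ℝ => (√|s|)⁻¹) volume 0 b := by
      intro b
      rcases le_total 0 b with hb | hb
      · exact hpos b hb
      · have h := hpos (-b) (by linarith)
        rw [IntervalIntegrable.iff_comp_neg] at h
        simpa using h
    intro a b
    exact (hall a).symm.trans (hall b)
  have h := (h0 (a - r0) (b - r0)).comp_sub_right r0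
  simpa using h

/-- The beta kernel. -/
noncomputable def betaK (t : ℝ) : ℝ := (√t)⁻¹ * (√(1 - t))⁻¹

lemma betaK_nonneg (t : ℝ) : 0 ≤ betaK t := by unfold betaK; positivity

lemma betaK_eq_zero {t : ℝ} (h : t ∉ Ioo (0:ℝ) 1) : betaK t = 0 := by
  unfold betaK
  by_cases h0 : t ≤ 0
  · simp [Real.sqrt_eq_zero_of_nonpos h0]
  · have : 1 ≤ t := by
      by_contra h1
      exact h ⟨not_le.1 h0, not_le.1 h1⟩
    rw [Real.sqrt_eq_zero_of_nonpos (by linarith : 1 - t ≤ 0)]; simp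

lemma betaK_integrable : Integrable betaK := by
  have hm : Measurable betaK := by unfold betaK; fun_prop
  have hI : IntegrableOn betaK (Ioc 0 1) := by
    have h1 := (intble_inv_sqrt_abs 0 0 1).add (intble_inv_sqrt_abs 1 0 1)
    rw [intervalIntegrable_iff_integrableOn_Ioc_of_le zero_le_one] at h1
    refine Integrable.mono' h1 hm.aestronglyMeasurable ?_
    filter_upwards [ae_restrict_mem measurableSet_Ioc] with t ht
    rw [Real.norm_of_nonneg (betaK_nonneg t)]
    simp only [Pi.add_apply, sub_zero]
    by_cases h : t ∈ Ioo (0:ℝ) 1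
    · have hp : 0 < √t := Real.sqrt_pos.2 h.1
      have hq : 0 < √(1 - t) := Real.sqrt_pos.2 (by linarith [h.2])
      have hp2 : √t ^ 2 = t := Real.sq_sqrt h.1.le
      have hq2 : √(1 - t) ^ 2 = 1 - t := Real.sq_sqrt (by linarith [h.2])
      rw [abs_of_pos h.1, show |t - 1| = 1 - t by
        rw [abs_of_neg (by linarith [h.2])]; ring]
      unfold betaK
      have : 1 ≤ √t + √(1 - t) := by nlinarith
      rw [← mul_inv, inv_add_inv hp.ne' hq.ne', ← one_div]
      gcongr
    · rw [betaK_eq_zero h]; positivity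
  refine (integrableOn_iff_integrable_of_support_subset ?_).1 hI
  intro t ht
  by_contra h
  exact ht (betaK_eq_zero fun h' => h ⟨h'.1, h'.2.le⟩)

lemma betaK_integral_pos : 0 < ∫ t, betaK t := by
  rw [integral_pos_iff_support_of_nonneg betaK_nonneg betaK_integrable]
  have : Ioo (0:ℝ) 1 ⊆ Function.support betaK := by
    intro t ht
    have hp : 0 < √t := Real.sqrt_pos.2 ht.1
    have hq : 0 < √(1 - t) := Real.sqrt_pos.2 (by linarith [ht.2])
    have : 0 < betaK t := by unfold betaK; positivity
    exact this.ne'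
  refine lt_of_lt_of_le ?_ (measure_mono this)
  simp

lemma abelK_eq {a b : ℝ} (hab : a < b) (x : ℝ) :
    (√(x - a))⁻¹ * (√(b - x))⁻¹ = (b - a)⁻¹ * betaK ((b - a)⁻¹ * (x + -a)) := by
  have hd : 0 < b - a := by linarith
  unfold betaK
  have h1 : (b - a)⁻¹ * (x + -a) = (x - a) / (b - a) := by field_simp; ring
  have h2 : 1 - (x - a) / (b - a) = (b - x) / (b - a) := by field_simp; ring
  rw [h1, h2, Real.sqrt_div' _ hd.le, Real.sqrt_div' _ hd.le]
  have hs : √(b - a) * √(b - a) = b - a := Real.mul_self_sqrt hd.le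
  have hs0 : 0 < √(b - a) := Real.sqrt_pos.2 hd
  rw [inv_div, inv_div, div_mul_div_comm, hs]
  rw [← mul_inv, div_eq_mul_inv, ← mul_assoc, inv_mul_cancel₀ hd.ne', one_mul]

lemma abelK_integrable (a b : ℝ) :
    Integrable (fun x => (√(x - a))⁻¹ * (√(b - x))⁻¹) := by
  rcases lt_or_ge a b with hab | hab
  · simp_rw [abelK_eq hab]
    refine Integrable.const_mul ?_ _
    have h := betaK_integrable.comp_mul_left' (R := (b - a)⁻¹)
      (inv_ne_zero (by linarith))
    exact h.comp_add_right (-a)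
  · have : (fun x => (√(x - a))⁻¹ * (√(b - x))⁻¹) = fun _ => (0:ℝ) := by
      funext x
      rcases le_total x a with h | h
      · rw [Real.sqrt_eq_zero_of_nonpos (by linarith : x - a ≤ 0)]; simp
      · rw [Real.sqrt_eq_zero_of_nonpos (by linarith : b - x ≤ 0)]; simp
    rw [this]; exact integrable_zero _ _ _

lemma abelK_integral (a b : ℝ) :
    ∫ x, (√(x - a))⁻¹ * (√(b - x))⁻¹ = if a < b then ∫ t, betaK t else 0 := by
  split_ifs with hab
  · simp_rw [abelK_eq hab]
    rw [integral_const_mul, integral_add_right_eq_self (fun x => betaK ((b - a)⁻¹ * x)) (-a),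
      Measure.integral_comp_mul_left, inv_inv, abs_of_pos (by linarith), smul_eq_mul,
      ← mul_assoc, inv_mul_cancel₀ (by linarith), one_mul]
  · have : (fun x => (√(x - a))⁻¹ * (√(b - x))⁻¹) = fun _ => (0:ℝ) := by
      funext x
      rcases le_total x a with h | h
      · rw [Real.sqrt_eq_zero_of_nonpos (by linarith : x - a ≤ 0)]; simp
      · rw [Real.sqrt_eq_zero_of_nonpos (by linarith : b - x ≤ 0)]; simp
    rw [this]; simp

lemma sqrt_diff_bound (a b : ℝ) (hb : b ≠ 0) :
    |√a - √b| ≤ |a - b| * (√|b|)⁻¹ := by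
  have hs : 0 < √|b| := Real.sqrt_pos.2 (abs_pos.2 hb)
  rw [← div_eq_mul_inv, le_div_iff₀ hs]
  rcases lt_or_gt_of_ne hb with h | h
  · rw [Real.sqrt_eq_zero_of_nonpos h.le, sub_zero, abs_of_nonneg (Real.sqrt_nonneg a)]
    rcases le_total a 0 with ha | ha
    · rw [Real.sqrt_eq_zero_of_nonpos ha]; simp
    · rw [abs_of_neg h]
      rw [abs_of_pos (by linarith : 0 < a - b)]
      have h1 : √a ^ 2 = a := Real.sq_sqrt ha
      have h2 : √(-b) ^ 2 = -b := Real.sq_sqrt (by linarith)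
      nlinarith [sq_nonneg (√a - √(-b))]
  · rw [abs_of_pos h]
    rcases le_total a 0 with ha | ha
    · rw [Real.sqrt_eq_zero_of_nonpos ha]
      rw [zero_sub, abs_neg, abs_of_nonneg (Real.sqrt_nonneg b), Real.mul_self_sqrt h.le,
        abs_of_neg (by linarith)]
      linarith
    · have h1 : √a ^ 2 = a := Real.sq_sqrt ha
      have h2 : √b ^ 2 = b := Real.sq_sqrt h.le
      have h3 : a - b = (√a - √b) * (√a + √b) := by linear_combination -h1 + h2
      rw [h3, abs_mul, abs_of_nonneg (by positivity : 0 ≤ √a + √b)]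
      gcongr
      linarith [Real.sqrt_nonneg a]

/-- `w · g^{-1/2}` is integrable if `|g|` grows at least linearly away from a point. -/
lemma intble_inv_sqrt {R : ℝ} (hR1 : R < 1) {g w : ℝ → ℝ} {k r0 : ℝ} (hk : 0 < k)
    (hg : ContinuousOn g (Icc R 1)) (hw : ContinuousOn w (Icc R 1))
    (hlow : ∀ s ∈ Icc R 1, k * |s - r0| ≤ |g s|) :
    IntervalIntegrable (fun s => w s * (√(g s))⁻¹) volume R 1 := by
  obtain ⟨M, hM⟩ := isCompact_Icc.exists_bound_of_continuousOn hw
  have hb := (intble_inv_sqrt_abs r0 R 1).const_mul (M * (√k)⁻¹)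
  have hsub : Ioc R 1 ⊆ Icc R 1 := Ioc_subset_Icc_self
  rw [intervalIntegrable_iff_integrableOn_Ioc_of_le hR1.le] at hb ⊢
  refine Integrable.mono' hb ?_ ?_
  · refine AEStronglyMeasurable.mul ((hw.mono hsub).aestronglyMeasurable measurableSet_Ioc) ?_
    have := ((hg.mono hsub).aemeasurable (μ := volume) measurableSet_Ioc)
    exact (this.sqrt.inv).aestronglyMeasurable
  · have hne : ∀ᵐ s ∂(volume.restrict (Ioc R 1)), s ≠ r0 :=
      ae_restrict_of_ae (by simp [ae_iff])
    filter_upwards [ae_restrict_mem measurableSet_Ioc, hne] with s hs hs0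
    have hp : 0 < |s - r0| := abs_pos.2 (sub_ne_zero.2 hs0)
    have hM0 : 0 ≤ M := le_trans (norm_nonneg _) (hM s (hsub hs))
    rw [norm_mul, mul_assoc]
    refine mul_le_mul (hM s (hsub hs)) ?_ (norm_nonneg _) hM0
    rw [Real.norm_of_nonneg (by positivity)]
    rcases le_or_gt (g s) 0 with h0 | h0
    · rw [Real.sqrt_eq_zero_of_nonpos h0, inv_zero]; positivity
    · rw [← mul_inv, ← Real.sqrt_mul hk.le]
      have := hlow s (hsub hs)
      rw [abs_of_pos h0] at this
      have h2 : 0 < √(k * |s - r0|) := Real.sqrt_pos.2 (by positivity)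
      gcongr

/-- Differentiation of `∫ √(g t s) ds` in the parameter `t`. -/
lemma hasDerivAt_int_sqrt {R : ℝ} (hR1 : R < 1) {g : ℝ → ℝ → ℝ} {g' : ℝ → ℝ} {t0 k r0 C : ℝ}
    (hk : 0 < k)
    (hg : ∀ᶠ t in 𝓝 t0, ContinuousOn (g t) (Icc R 1))
    (hlip : ∀ᶠ t in 𝓝 t0, ∀ s ∈ Icc R 1, |g t s - g t0 s| ≤ C * |t - t0|)
    (hder : ∀ s ∈ Icc R 1, HasDerivAt (fun t => g t s) (g' s) t0)
    (hlow : ∀ s ∈ Icc R 1, k * |s - r0| ≤ |g t0 s|) :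
    HasDerivAt (fun t => ∫ s in R..1, √(g t s)) (∫ s in R..1, g' s / 2 * (√(g t0 s))⁻¹) t0 := by
  have hsub : Ioc R 1 ⊆ Icc R 1 := Ioc_subset_Icc_self
  have hne : ∀ᵐ s : ℝ, s ≠ r0 := by simp [ae_iff]
  have hg0 : ContinuousOn (g t0) (Icc R 1) := hg.self_of_nhds
  have hint : ∀ t, ContinuousOn (g t) (Icc R 1) →
      IntervalIntegrable (fun s => √(g t s)) volume R 1 := by
    intro t ht
    refine ContinuousOn.intervalIntegrable ?_
    rw [uIcc_of_le hR1.le]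
    exact ht.sqrt
  rw [hasDerivAt_iff_tendsto_slope]
  have hkey : Tendsto (fun t => ∫ s in R..1, slope (fun t => √(g t s)) t0 t) (𝓝[≠] t0)
      (𝓝 (∫ s in R..1, g' s / 2 * (√(g t0 s))⁻¹)) := by
    have hb := (intble_inv_sqrt_abs r0 R 1).const_mul (|C| * (√k)⁻¹)
    refine intervalIntegral.tendsto_integral_filter_of_dominated_convergence _ ?_ ?_ hb ?_
    · filter_upwards [nhdsWithin_le_nhds hg] with t ht
      rw [uIoc_of_le hR1.le]
      have := (ht.sqrt.sub hg0.sqrt).const_smul ((t - t0)⁻¹)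
      exact (this.mono hsub).aestronglyMeasurable measurableSet_Ioc
    · filter_upwards [nhdsWithin_le_nhds hlip, self_mem_nhdsWithin] with t ht htne
      filter_upwards [hne] with s hs0 hs
      rw [uIoc_of_le hR1.le] at hs
      have hp : 0 < |s - r0| := abs_pos.2 (sub_ne_zero.2 hs0)
      have hl := hlow s (hsub hs)
      have hgne : g t0 s ≠ 0 := by
        intro h; rw [h, abs_zero] at hl
        have : 0 < k * |s - r0| := by positivity
        linarith
      have htt : 0 < |t - t0| := abs_pos.2 (sub_ne_zero.2 htne)
      rw [slope_def_field, norm_div, Real.norm_eq_abs, Real.norm_eq_abs, div_le_iff₀ htt]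
      refine (sqrt_diff_bound _ _ hgne).trans ?_
      have h1 := ht s (hsub hs)
      have h2 : (√|g t0 s|)⁻¹ ≤ (√k)⁻¹ * (√|s - r0|)⁻¹ := by
        rw [← mul_inv, ← Real.sqrt_mul hk.le]
        have h2 : 0 < √(k * |s - r0|) := Real.sqrt_pos.2 (by positivity)
        gcongr
      calc |g t s - g t0 s| * (√|g t0 s|)⁻¹
          ≤ (|C| * |t - t0|) * ((√k)⁻¹ * (√|s - r0|)⁻¹) := by
            gcongr
            exact h1.trans (by gcongr; exact le_abs_self C)
        _ = _ := by ring
    · filter_upwards [hne] with s hs0 hs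
      rw [uIoc_of_le hR1.le] at hs
      have hp : 0 < |s - r0| := abs_pos.2 (sub_ne_zero.2 hs0)
      have hl := hlow s (hsub hs)
      have hgne : g t0 s ≠ 0 := by
        intro h; rw [h, abs_zero] at hl
        have : 0 < k * |s - r0| := by positivity
        linarith
      have := (hder s (hsub hs)).sqrt hgne
      rw [hasDerivAt_iff_tendsto_slope] at this
      convert this using 2
      rw [div_mul_eq_mul_div, ← div_eq_mul_inv, div_div, mul_comm 2]
  refine hkey.congr' ?_
  filter_upwards [nhdsWithin_le_nhds hg] with t ht
  simp only [slope_def_field]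
  rw [intervalIntegral.integral_div, intervalIntegral.integral_sub (hint t ht) (hint t0 hg0)]

/-- Herglotz condition gives a quantitative lower bound. -/
lemma herglotz_lower {R : ℝ} (hR0 : 0 < R) (hR1 : R < 1) {c : ℝ → ℝ}
    (hpos : ∀ r ∈ Icc R 1, 0 < c r) (hC : IsC11On c R) (hH : HerglotzCond c R) :
    ∃ k > 0, ∀ s ∈ Icc R 1, ∀ t ∈ Icc R 1, s ≤ t → k * (t - s) ≤ t / c t - s / c s := by
  obtain ⟨c', K, hd, hl⟩ := hC
  have hcc : ContinuousOn c (Icc R 1) := fun r hr => (hd r hr).continuousWithinAt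
  have hfd : ∀ r ∈ Icc R 1, HasDerivWithinAt (fun s => s / c s)
      ((1 * c r - r * c' r) / c r ^ 2) (Icc R 1) r := fun r hr =>
    (hasDerivWithinAt_id r _).div (hd r hr) (hpos r hr).ne'
  have hfc : ContinuousOn (fun r => (1 * c r - r * c' r) / c r ^ 2) (Icc R 1) := by
    refine ContinuousOn.div ?_ (hcc.pow 2) fun r hr => (pow_pos (hpos r hr) 2).ne'
    exact (continuousOn_const.mul hcc).sub (continuousOn_id.mul hl.continuousOn)
  obtain ⟨x, hx, hmin⟩ := isCompact_Icc.exists_isMinOn (nonempty_Icc.2 hR1.le) hfc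
  have hder : ∀ r ∈ Icc R 1, derivWithin (fun s => s / c s) (Icc R 1) r
      = (1 * c r - r * c' r) / c r ^ 2 := fun r hr =>
    (hfd r hr).derivWithin (uniqueDiffOn_Icc hR1 r hr)
  refine ⟨_, by simpa [hder x hx] using hH x hx, ?_⟩
  have hat : ∀ r ∈ interior (Icc R 1), HasDerivAt (fun s => s / c s)
      ((1 * c r - r * c' r) / c r ^ 2) r := fun r hr =>
    (hfd r (interior_subset hr)).hasDerivAt (mem_interior_iff_mem_nhds.1 hr)
  have := (convex_Icc R 1).mul_sub_le_image_sub_of_le_deriv (f := fun s => s / c s)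
    (C := (c x - x * c' x) / c x ^ 2)
    (fun r hr => (hfd r hr).continuousWithinAt)
    (fun r hr => (hat r hr).differentiableAt.differentiableWithinAt)
    (fun r hr => by
      rw [(hat r hr).deriv]
      have := hmin (interior_subset hr)
      simpa using this)
  exact this

set_option linter.unusedSectionVars false

/-- The function whose critical values give the length spectrum. -/
noncomputable def Ffun (c : ℝ → ℝ) (R z : ℝ) : ℝ :=
  ∫ s in R..1, √(1 / (c s) ^ 2 - z ^ 2 / s ^ 2)

/-- The angle function in terms of the angular momentum. -/
noncomputable def Afun (c : ℝ → ℝ) (R z : ℝ) : ℝ :=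
  ∫ s in R..1, z / s ^ 2 * (√(1 / (c s) ^ 2 - z ^ 2 / s ^ 2))⁻¹

lemma cont_g {R : ℝ} (hR0 : 0 < R) {c : ℝ → ℝ} (hpos : ∀ r ∈ Icc R 1, 0 < c r)
    (hcc : ContinuousOn c (Icc R 1)) (z : ℝ) :
    ContinuousOn (fun s => 1 / (c s) ^ 2 - z ^ 2 / s ^ 2) (Icc R 1) := by
  refine ContinuousOn.sub (continuousOn_const.div (hcc.pow 2) fun s hs => ?_)
    (continuousOn_const.div (continuousOn_id.pow 2) fun s hs => ?_)
  · exact (pow_pos (hpos s hs) 2).ne'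
  · exact (pow_pos (hR0.trans_le hs.1) 2).ne'

lemma cont_rho {R : ℝ} {c : ℝ → ℝ} (hpos : ∀ r ∈ Icc R 1, 0 < c r)
    (hcc : ContinuousOn c (Icc R 1)) : ContinuousOn (fun s => s / c s) (Icc R 1) :=
  continuousOn_id.div hcc fun s hs => (hpos s hs).ne'

lemma g_low {R : ℝ} (hR0 : 0 < R) (hR1 : R < 1) {c : ℝ → ℝ} (hpos : ∀ r ∈ Icc R 1, 0 < c r)
    (hcc : ContinuousOn c (Icc R 1)) {k : ℝ} (hk0 : 0 < k)
    (hk : ∀ s ∈ Icc R 1, ∀ t ∈ Icc R 1, s ≤ t → k * (t - s) ≤ t / c t - s / c s)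
    {z : ℝ} (hz : 0 < z) (hz1 : z < 1 / c 1) :
    ∃ r0, ∀ s ∈ Icc R 1, (k * z) * |s - r0| ≤ |1 / (c s) ^ 2 - z ^ 2 / s ^ 2| := by
  have hmain : ∃ r0, ∀ s ∈ Icc R 1, k * |s - r0| ≤ |s / c s - z| := by
    have hRm : R ∈ Icc R 1 := ⟨le_rfl, hR1.le⟩
    rcases le_or_gt z (R / c R) with h | h
    · refine ⟨R, fun s hs => ?_⟩
      have := hk R hRm s hs hs.1
      rw [abs_of_nonneg (by linarith [hs.1])]
      exact le_trans (by linarith) (le_abs_self _)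
    · obtain ⟨r0, hr0, hr0z⟩ := intermediate_value_Icc hR1.le (cont_rho hpos hcc)
        (show z ∈ Icc (R / c R) (1 / c 1) from ⟨h.le, hz1.le⟩)
      simp only at hr0z
      refine ⟨r0, fun s hs => ?_⟩
      rcases le_total s r0 with h' | h'
      · have := hk s hs r0 hr0 h'
        rw [abs_of_nonpos (by linarith : s - r0 ≤ 0)]
        refine le_trans ?_ (neg_le_abs _)
        rw [← hr0z]; linarith
      · have := hk r0 hr0 s hs h'
        rw [abs_of_nonneg (by linarith : 0 ≤ s - r0)]
        refine le_trans ?_ (le_abs_self _)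
        rw [← hr0z]; linarith
  obtain ⟨r0, hr0⟩ := hmain
  refine ⟨r0, fun s hs => ?_⟩
  have hs0 : 0 < s := hR0.trans_le hs.1
  have hc0 := hpos s hs
  have e : 1 / (c s) ^ 2 - z ^ 2 / s ^ 2 = (s / c s - z) * ((s / c s + z) / s ^ 2) := by
    field_simp; ring
  have hz' : z ≤ (s / c s + z) / s ^ 2 := by
    rw [le_div_iff₀ (by positivity)]
    have h1 : s ^ 2 ≤ 1 := by nlinarith [hs.2]
    have h2 : 0 < s / c s := by positivity
    nlinarith
  rw [e, abs_mul, abs_of_pos (lt_of_lt_of_le hz hz')]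
  calc k * z * |s - r0| = (k * |s - r0|) * z := by ring
    _ ≤ _ := mul_le_mul (hr0 s hs) hz' hz.le (abs_nonneg _)

lemma F_deriv {R : ℝ} (hR0 : 0 < R) (hR1 : R < 1) {c : ℝ → ℝ} (hpos : ∀ r ∈ Icc R 1, 0 < c r)
    (hcc : ContinuousOn c (Icc R 1)) {k : ℝ} (hk0 : 0 < k)
    (hk : ∀ s ∈ Icc R 1, ∀ t ∈ Icc R 1, s ≤ t → k * (t - s) ≤ t / c t - s / c s)
    {z : ℝ} (hz : 0 < z) (hz1 : z < 1 / c 1) :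
    HasDerivAt (Ffun c R) (- Afun c R z) z := by
  obtain ⟨r0, hr0⟩ := g_low hR0 hR1 hpos hcc hk0 hk hz hz1
  have h := hasDerivAt_int_sqrt hR1 (g := fun t s => 1 / (c s) ^ 2 - t ^ 2 / s ^ 2)
    (g' := fun s => - (2 * z / s ^ 2)) (t0 := z) (k := k * z) (r0 := r0)
    (C := (2 * z + 1) / R ^ 2) (by positivity)
    (Eventually.of_forall fun t => cont_g hR0 hpos hcc t) ?_ ?_ hr0
  · unfold Ffun Afun
    convert h using 1
    rw [← intervalIntegral.integral_neg]
    congr 1; funext s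
    ring
  · filter_upwards [Metric.ball_mem_nhds z one_pos] with t ht s hs
    rw [Metric.mem_ball, Real.dist_eq] at ht
    have hs0 : 0 < s := hR0.trans_le hs.1
    have e : 1 / (c s) ^ 2 - t ^ 2 / s ^ 2 - (1 / (c s) ^ 2 - z ^ 2 / s ^ 2)
        = (- (t + z)) / s ^ 2 * (t - z) := by ring
    rw [e, abs_mul, abs_div, abs_neg, abs_of_pos (by positivity : 0 < s ^ 2)]
    have h1 : |t + z| ≤ 2 * z + 1 := by
      have h2 := abs_lt.1 ht
      exact abs_le.2 ⟨by linarith, by linarith⟩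
    have := hs.1
    gcongr
  · intro s hs
    have := ((hasDerivAt_pow 2 z).div_const (s ^ 2)).const_sub (1 / (c s) ^ 2)
    simpa using this

lemma pt_sqrt {c s z : ℝ} (hc : 0 < c) (hs : 0 < s) :
    √(1 - (z * c / s) ^ 2) = c * √(1 / c ^ 2 - z ^ 2 / s ^ 2) := by
  have : 1 - (z * c / s) ^ 2 = c ^ 2 * (1 / c ^ 2 - z ^ 2 / s ^ 2) := by field_simp
  rw [this, Real.sqrt_mul (by positivity), Real.sqrt_sq hc.le]

lemma pt_beta {c s z : ℝ} (hc : 0 < c) (hs : 0 < s) :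
    (z * c / s ^ 2) * (√(1 - (z * c / s) ^ 2))⁻¹
      = z / s ^ 2 * (√(1 / c ^ 2 - z ^ 2 / s ^ 2))⁻¹ := by
  rw [pt_sqrt hc hs, mul_inv]
  field_simp

lemma pt_T {c s z : ℝ} (hc : 0 < c) (hs : 0 < s) :
    c⁻¹ * (√(1 - (z * c / s) ^ 2))⁻¹
      = √(1 / c ^ 2 - z ^ 2 / s ^ 2)
        + z * (z / s ^ 2 * (√(1 / c ^ 2 - z ^ 2 / s ^ 2))⁻¹) := by
  rw [pt_sqrt hc hs, mul_inv]
  rcases le_or_gt (1 / c ^ 2 - z ^ 2 / s ^ 2) 0 with h | h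
  · rw [Real.sqrt_eq_zero_of_nonpos h]; simp
  · have hq : 0 < √(1 / c ^ 2 - z ^ 2 / s ^ 2) := Real.sqrt_pos.2 h
    have hq2 := Real.sq_sqrt h.le
    set q := √(1 / c ^ 2 - z ^ 2 / s ^ 2)
    have h1 : 1 / c ^ 2 = q ^ 2 + z ^ 2 / s ^ 2 := by linarith
    have h2 : c⁻¹ * (c⁻¹ * q⁻¹) = 1 / c ^ 2 * q⁻¹ := by field_simp
    rw [h2, h1]
    field_simp

section geom
variable {R : ℝ} (hR0 : 0 < R) (hR1 : R < 1) {c : ℝ → ℝ} (hpos : ∀ r ∈ Icc R 1, 0 < c r)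
    (hcc : ContinuousOn c (Icc R 1)) {k : ℝ} (hk0 : 0 < k)
    (hk : ∀ s ∈ Icc R 1, ∀ t ∈ Icc R 1, s ≤ t → k * (t - s) ≤ t / c t - s / c s)
include hR0 hR1 hpos hcc hk0 hk

lemma A_intble {z : ℝ} (hz : 0 < z) (hz1 : z < 1 / c 1) :
    IntervalIntegrable (fun s => z / s ^ 2 * (√(1 / (c s) ^ 2 - z ^ 2 / s ^ 2))⁻¹)
      volume R 1 := by
  obtain ⟨r0, hr0⟩ := g_low hR0 hR1 hpos hcc hk0 hk hz hz1
  refine intble_inv_sqrt hR1 (k := k * z) (r0 := r0) (by positivity)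
    (cont_g hR0 hpos hcc z) ?_ hr0
  exact continuousOn_const.div (continuousOn_id.pow 2)
    fun s hs => (pow_pos (hR0.trans_le hs.1) 2).ne'

lemma F_intble (z : ℝ) :
    IntervalIntegrable (fun s => √(1 / (c s) ^ 2 - z ^ 2 / s ^ 2)) volume R 1 := by
  refine ContinuousOn.intervalIntegrable ?_
  rw [uIcc_of_le hR1.le]
  exact (cont_g hR0 hpos hcc z).sqrt

lemma beta_eq (z : ℝ) : betaFun c R z = Afun c R z := by
  unfold betaFun Afun
  refine intervalIntegral.integral_congr fun s hs => ?_
  rw [uIcc_of_le hR1.le] at hs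
  exact pt_beta (hpos s hs) (hR0.trans_le hs.1)

lemma T_eq {z : ℝ} (hz : 0 < z) (hz1 : z < 1 / c 1) :
    Tfun c R z = Ffun c R z + z * Afun c R z := by
  unfold Tfun Ffun Afun
  rw [← intervalIntegral.integral_const_mul, ← intervalIntegral.integral_add
    (F_intble hR0 hR1 hpos hcc hk0 hk z)
    ((A_intble hR0 hR1 hpos hcc hk0 hk hz hz1).const_mul z)]
  refine intervalIntegral.integral_congr fun s hs => ?_
  rw [uIcc_of_le hR1.le] at hs
  exact pt_T (hpos s hs) (hR0.trans_le hs.1)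

lemma rho_mem {r : ℝ} (hr : r ∈ Ioo R 1) : 0 < r / c r ∧ r / c r < 1 / c 1 := by
  have hrI : r ∈ Icc R 1 := ⟨hr.1.le, hr.2.le⟩
  refine ⟨div_pos (hR0.trans hr.1) (hpos r hrI), ?_⟩
  have := hk r hrI 1 ⟨hR1.le, le_rfl⟩ hr.2.le
  have h2 : 0 < k * (1 - r) := mul_pos hk0 (by linarith [hr.2])
  linarith

lemma g_nonpos {r s : ℝ} (hr : r ∈ Icc R 1) (hs : s ∈ Icc R 1) (hsr : s ≤ r) :
    1 / (c s) ^ 2 - (r / c r) ^ 2 / s ^ 2 ≤ 0 := by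
  have hs0 : 0 < s := hR0.trans_le hs.1
  have hc0 := hpos s hs
  have e : 1 / (c s) ^ 2 - (r / c r) ^ 2 / s ^ 2
      = ((s / c s) ^ 2 - (r / c r) ^ 2) / s ^ 2 := by
    field_simp
  rw [e]
  have h1 := hk s hs r hr hsr
  have h2 : 0 ≤ k * (r - s) := mul_nonneg hk0.le (by linarith)
  have h3 : 0 < s / c s := by positivity
  refine div_nonpos_of_nonpos_of_nonneg ?_ (by positivity)
  nlinarith

lemma alpha_eq {r : ℝ} (hr : r ∈ Ioo R 1) : alphaFun c r = Afun c R (r / c r) := by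
  have hrI : r ∈ Icc R 1 := ⟨hr.1.le, hr.2.le⟩
  obtain ⟨hz, hz1⟩ := rho_mem hR0 hR1 hpos hcc hk0 hk hr
  have hi := A_intble hR0 hR1 hpos hcc hk0 hk hz hz1
  unfold alphaFun Afun
  have hm : r ∈ uIcc R 1 := by rw [uIcc_of_le hR1.le]; exact hrI
  rw [← intervalIntegral.integral_add_adjacent_intervals
    (hi.mono_set (uIcc_subset_uIcc_left hm)) (hi.mono_set (uIcc_subset_uIcc_right hm))]
  have h0 : ∫ s in R..r, (r / c r) / s ^ 2 * (√(1 / (c s) ^ 2 - (r / c r) ^ 2 / s ^ 2))⁻¹ = 0 := by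
    rw [← intervalIntegral.integral_zero (a := R) (b := r)]
    refine intervalIntegral.integral_congr fun s hs => ?_
    rw [uIcc_of_le hr.1.le] at hs
    rw [Real.sqrt_eq_zero_of_nonpos (g_nonpos hR0 hR1 hpos hcc hk0 hk hrI
      ⟨hs.1, hs.2.trans hr.2.le⟩ hs.2)]
    simp
  rw [h0, zero_add]
  refine intervalIntegral.integral_congr fun s hs => ?_
  rw [uIcc_of_le hr.2.le] at hs
  have hsI : s ∈ Icc R 1 := ⟨hr.1.le.trans hs.1, hs.2⟩
  have hs0 : 0 < s := hR0.trans_le hsI.1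
  have hcr := hpos r hrI
  rw [← pt_beta (hpos s hsI) hs0]
  have e1 : r * c s / (s * c r) = r / c r * c s / s := by field_simp
  have e2 : r * c s / (c r * s ^ 2) = r / c r * c s / s ^ 2 := by field_simp
  rw [e1, e2]

lemma L_eq {r : ℝ} (hr : r ∈ Ioo R 1) :
    Lfun c r = Ffun c R (r / c r) + (r / c r) * Afun c R (r / c r) := by
  have hrI : r ∈ Icc R 1 := ⟨hr.1.le, hr.2.le⟩
  obtain ⟨hz, hz1⟩ := rho_mem hR0 hR1 hpos hcc hk0 hk hr
  have hi2 := (A_intble hR0 hR1 hpos hcc hk0 hk hz hz1).const_mul (r / c r)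
  have hi1 := F_intble hR0 hR1 hpos hcc hk0 hk (r / c r)
  have hi := hi1.add hi2
  unfold Lfun Ffun Afun
  rw [← intervalIntegral.integral_const_mul, ← intervalIntegral.integral_add hi1 hi2]
  have hm : r ∈ uIcc R 1 := by rw [uIcc_of_le hR1.le]; exact hrI
  rw [← intervalIntegral.integral_add_adjacent_intervals
    (hi.mono_set (uIcc_subset_uIcc_left hm)) (hi.mono_set (uIcc_subset_uIcc_right hm))]
  have h0 : ∫ s in R..r, (√(1 / (c s) ^ 2 - (r / c r) ^ 2 / s ^ 2) + r / c r *
      ((r / c r) / s ^ 2 * (√(1 / (c s) ^ 2 - (r / c r) ^ 2 / s ^ 2))⁻¹)) = 0 := by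
    rw [← intervalIntegral.integral_zero (a := R) (b := r)]
    refine intervalIntegral.integral_congr fun s hs => ?_
    rw [uIcc_of_le hr.1.le] at hs
    rw [Real.sqrt_eq_zero_of_nonpos (g_nonpos hR0 hR1 hpos hcc hk0 hk hrI
      ⟨hs.1, hs.2.trans hr.2.le⟩ hs.2)]
    simp
  rw [h0, zero_add]
  refine intervalIntegral.integral_congr fun s hs => ?_
  rw [uIcc_of_le hr.2.le] at hs
  have hsI : s ∈ Icc R 1 := ⟨hr.1.le.trans hs.1, hs.2⟩
  have hs0 : 0 < s := hR0.trans_le hsI.1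
  have hcr := hpos r hrI
  rw [← pt_T (hpos s hsI) hs0]
  have e1 : r * c s / (s * c r) = r / c r * c s / s := by field_simp
  rw [e1]

lemma Phi_deriv {z : ℝ} (hz : 0 < z) (hz1 : z < 1 / c 1) (n m : ℕ) :
    HasDerivAt (fun z => 2 * (n * Ffun c R z + m * Real.pi * z))
      (2 * (m * Real.pi - n * Afun c R z)) z := by
  have h1 := (F_deriv hR0 hR1 hpos hcc hk0 hk hz hz1).const_mul (n : ℝ)
  have h2 := (hasDerivAt_id z).const_mul (m * Real.pi)
  have h3 := (h1.add h2).const_mul 2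
  refine h3.congr_deriv ?_
  ring

lemma lsp_null : volume (lsp' c R) = 0 := by
  have hnull : ∀ n m : ℕ, volume ((fun z => 2 * (n * Ffun c R z + m * Real.pi * z)) ''
      {z | (0 < z ∧ z < 1 / c 1) ∧ (n : ℝ) * Afun c R z = m * Real.pi}) = 0 := by
    intro n m
    refine addHaar_image_eq_zero_of_det_fderivWithin_eq_zero volume
      (f' := fun _ => ContinuousLinearMap.toSpanSingleton ℝ (0:ℝ)) ?_ ?_
    · rintro z ⟨⟨hz, hz1⟩, he⟩
      have := Phi_deriv hR0 hR1 hpos hcc hk0 hk hz hz1 n m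
      rw [he, sub_self, mul_zero] at this
      exact this.hasFDerivAt.hasFDerivWithinAt
    · intro z _
      simp [ContinuousLinearMap.det]
  refine measure_mono_null ?_ (measure_iUnion_null fun n => measure_iUnion_null (hnull n))
  rintro l (⟨r, hr, n, m, hn, hm, hco, he, hl⟩ | ⟨z, hz, hzR, n, m, hn, hm, hco, he, hl⟩)
  · simp only [mem_iUnion]
    rw [alpha_eq hR0 hR1 hpos hcc hk0 hk hr] at he
    rw [L_eq hR0 hR1 hpos hcc hk0 hk hr] at hl
    refine ⟨n, m, r / c r, ⟨rho_mem hR0 hR1 hpos hcc hk0 hk hr, he⟩, ?_⟩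
    rw [hl]; simp only
    rw [← he]; ring
  · simp only [mem_iUnion]
    have hz1 : z < 1 / c 1 := by
      have := hk R ⟨le_rfl, hR1.le⟩ 1 ⟨hR1.le, le_rfl⟩ hR1.le
      have h2 : 0 ≤ k * (1 - R) := mul_nonneg hk0.le (by linarith)
      linarith
    rw [beta_eq hR0 hR1 hpos hcc hk0 hk] at he
    rw [T_eq hR0 hR1 hpos hcc hk0 hk hz hz1] at hl
    refine ⟨n, m, z, ⟨⟨hz, hz1⟩, he⟩, ?_⟩
    rw [hl]; simp only
    rw [← he]; ring

lemma crit_mem {z : ℝ} (hz : R / c R < z) (hz1 : z < 1 / c 1) {n m : ℕ} (hn : 0 < n)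
    (hm : 0 < m) (hco : Nat.Coprime n m)
    (hext : IsLocalExtr (fun z => 2 * (n * Ffun c R z + m * Real.pi * z)) z) :
    2 * (n * Ffun c R z + m * Real.pi * z) ∈ lsp' c R := by
  have hRc : 0 < R / c R := div_pos hR0 (hpos R ⟨le_rfl, hR1.le⟩)
  have hd := Phi_deriv hR0 hR1 hpos hcc hk0 hk (hRc.trans hz) hz1 n m
  have he0 := hext.hasDerivAt_eq_zero hd
  have he : (n : ℝ) * Afun c R z = m * Real.pi := by linarith
  obtain ⟨r, hr, hrz⟩ := intermediate_value_Ioo hR1.le (cont_rho hpos hcc)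
    (show z ∈ Ioo (R / c R) (1 / c 1) from ⟨hz, hz1⟩)
  simp only at hrz
  left
  refine ⟨r, hr, n, m, hn, hm, hco, ?_, ?_⟩
  · rw [alpha_eq hR0 hR1 hpos hcc hk0 hk hr, hrz, he]
  · rw [L_eq hR0 hR1 hpos hcc hk0 hk hr, hrz, ← he]; ring

end geom

lemma exists_gt_right {f : ℝ → ℝ} {a b d : ℝ} (hab : a < b) (h : HasDerivAt f d a)
    (hd : 0 < d) : ∃ x ∈ Ioo a b, f a < f x := by
  have h1 := (h.tendsto_slope).eventually (lt_mem_nhds hd)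
  have h2 : ∀ᶠ x in 𝓝[>] a, 0 < slope f a x :=
    h1.filter_mono (nhdsWithin_mono a fun x hx => ne_of_gt hx)
  obtain ⟨x, hx, hx2⟩ := (h2.and (Ioo_mem_nhdsGT hab)).exists
  refine ⟨x, hx2, ?_⟩
  rw [slope_def_field, div_pos_iff_of_pos_right (by linarith [hx2.1])] at hx
  linarith

lemma exists_gt_left {f : ℝ → ℝ} {a b d : ℝ} (hab : a < b) (h : HasDerivAt f d b)
    (hd : d < 0) : ∃ x ∈ Ioo a b, f b < f x := by
  have h1 := (h.tendsto_slope).eventually (gt_mem_nhds hd)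
  have h2 : ∀ᶠ x in 𝓝[<] b, slope f b x < 0 :=
    h1.filter_mono (nhdsWithin_mono b fun x hx => ne_of_lt hx)
  obtain ⟨x, hx, hx2⟩ := (h2.and (Ioo_mem_nhdsLT hab)).exists
  refine ⟨x, hx2, ?_⟩
  by_contra hcon
  rw [slope_def_field] at hx
  have := div_nonneg_of_nonpos (by linarith : f x - f b ≤ 0) (by linarith [hx2.2] : x - b ≤ 0)
  linarith

/-- Persistence of an interior maximum; the maximal value moves in a null set so it is constant. -/
lemma persist {T : Set ℝ} (hT : IsOpen T) {τ0 : ℝ} (hτ0 : τ0 ∈ T) {G : ℝ → ℝ → ℝ}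
    (hG : ContinuousOn (fun p : ℝ × ℝ => G p.1 p.2) (T ×ˢ univ)) {z1 z2 : ℝ} (hz : z1 < z2)
    {d1 d2 : ℝ} (h1 : HasDerivAt (G τ0) d1 z1) (hd1 : 0 < d1)
    (h2 : HasDerivAt (G τ0) d2 z2) (hd2 : d2 < 0) {S : Set ℝ} (hS : volume S = 0)
    (hcrit : ∀ᶠ τ in 𝓝 τ0, ∀ z ∈ Ioo z1 z2, IsLocalMax (G τ) z → G τ z ∈ S) :
    ∃ z ∈ Ioo z1 z2, ∀ᶠ τ in 𝓝 τ0, G τ z ≤ G τ0 z := by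
  have hGz : ∀ τ ∈ T, Continuous (G τ) := by
    intro τ hτ
    have : Continuous ((fun p : ℝ × ℝ => G p.1 p.2) ∘ fun z : ℝ => (τ, z)) := by
      rw [← continuousOn_univ]
      refine hG.comp (by fun_prop) ?_
      intro z _; exact ⟨hτ, mem_univ _⟩
    exact this
  have hGt : ∀ z, ContinuousAt (fun τ => G τ z) τ0 := by
    intro z
    have h := hG.continuousAt (x := (τ0, z)) ((hT.prod isOpen_univ).mem_nhds ⟨hτ0, mem_univ _⟩)
    exact ContinuousAt.comp (f := fun τ => (τ, z)) h (by fun_prop)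
  obtain ⟨zs, hzs, hmax⟩ := isCompact_Icc.exists_isMaxOn (nonempty_Icc.2 hz.le)
    (hGz τ0 hτ0).continuousOn
  have hs1 : G τ0 z1 < G τ0 zs := by
    obtain ⟨x, hx, hx2⟩ := exists_gt_right hz h1 hd1
    exact hx2.trans_le (hmax (Ioo_subset_Icc_self hx))
  have hs2 : G τ0 z2 < G τ0 zs := by
    obtain ⟨x, hx, hx2⟩ := exists_gt_left hz h2 hd2
    exact hx2.trans_le (hmax (Ioo_subset_Icc_self hx))
  have hint : ∀ x ∈ Icc z1 z2, x ≠ z1 → x ≠ z2 → x ∈ Ioo z1 z2 := fun x hx a b =>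
    ⟨lt_of_le_of_ne hx.1 (Ne.symm a), lt_of_le_of_ne hx.2 b⟩
  have hev : ∀ᶠ τ in 𝓝 τ0, τ ∈ T ∧ G τ z1 < G τ zs ∧ G τ z2 < G τ zs ∧
      ∀ z ∈ Ioo z1 z2, IsLocalMax (G τ) z → G τ z ∈ S := by
    filter_upwards [hT.mem_nhds hτ0, (hGt z1).eventually_lt (hGt zs) hs1,
      (hGt z2).eventually_lt (hGt zs) hs2, hcrit] with τ a b c d
    exact ⟨a, b, c, d⟩
  obtain ⟨δ, hδ, hball⟩ := Metric.eventually_nhds_iff_ball.1 hev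
  refine ⟨zs, hint zs hzs (fun h => by rw [h] at hs1; exact lt_irrefl _ hs1)
    (fun h => by rw [h] at hs2; exact lt_irrefl _ hs2), ?_⟩
  let f : Metric.ball τ0 δ → Icc z1 z2 → ℝ := fun τ z => G τ z
  have hfc : Continuous ↿f := by
    have : Continuous ((fun p : ℝ × ℝ => G p.1 p.2) ∘
        fun q : Metric.ball τ0 δ × Icc z1 z2 => ((q.1 : ℝ), (q.2 : ℝ))) := by
      rw [← continuousOn_univ]
      refine hG.comp (by fun_prop) ?_
      intro q _
      exact ⟨(hball q.1 q.1.2).1, mem_univ _⟩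
    exact this
  have hMc := IsCompact.continuous_sSup (K := (univ : Set (Icc z1 z2))) isCompact_univ hfc
  set M : Metric.ball τ0 δ → ℝ := fun τ => sSup (f τ '' univ) with hM
  have hMmax : ∀ τ : Metric.ball τ0 δ, ∀ x ∈ Icc z1 z2, (∀ y ∈ Icc z1 z2, G τ y ≤ G τ x) →
      M τ = G τ x := by
    intro τ x hx hy
    refine IsGreatest.csSup_eq ⟨⟨⟨x, hx⟩, mem_univ _, rfl⟩, ?_⟩
    rintro _ ⟨y, _, rfl⟩
    exact hy y y.2
  have hle : ∀ τ : Metric.ball τ0 δ, G τ zs ≤ M τ := by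
    intro τ
    obtain ⟨x, hx, hxm⟩ := isCompact_Icc.exists_isMaxOn (nonempty_Icc.2 hz.le)
      (hGz τ (hball τ τ.2).1).continuousOn
    rw [hMmax τ x hx fun y hy => hxm hy]
    exact hxm hzs
  have hMS : ∀ τ : Metric.ball τ0 δ, M τ ∈ S := by
    intro τ
    obtain ⟨hτT, b, c, d⟩ := hball τ τ.2
    obtain ⟨x, hx, hxm⟩ := isCompact_Icc.exists_isMaxOn (nonempty_Icc.2 hz.le)
      (hGz τ hτT).continuousOn
    rw [hMmax τ x hx fun y hy => hxm hy]
    have hxs : G τ zs ≤ G τ x := hxm hzs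
    have hxI := hint x hx (fun h => by rw [h] at hxs; linarith)
      (fun h => by rw [h] at hxs; linarith)
    exact d x hxI (hxm.isLocalMax (Icc_mem_nhds hxI.1 hxI.2))
  have hpre : IsPreconnected (range M) := by
    have : PreconnectedSpace (Metric.ball τ0 δ) :=
      Subtype.preconnectedSpace (convex_ball τ0 δ).isPreconnected
    exact isPreconnected_range hMc
  have hconst : ∀ a b : Metric.ball τ0 δ, ¬ M a < M b := by
    intro a b hab
    have hsub : Icc (M a) (M b) ⊆ S := (hpre.Icc_subset (mem_range_self a)
      (mem_range_self b)).trans (by rintro _ ⟨τ, rfl⟩; exact hMS τ)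
    have h0 := measure_mono_null hsub hS
    rw [Real.volume_Icc, ENNReal.ofReal_eq_zero] at h0
    linarith
  have hMτ0 : M ⟨τ0, Metric.mem_ball_self hδ⟩ = G τ0 zs :=
    hMmax _ zs hzs fun y hy => hmax hy
  filter_upwards [Metric.ball_mem_nhds τ0 hδ] with τ hτ
  have h3 := hle ⟨τ, hτ⟩
  have h4 := not_lt.1 (hconst ⟨τ0, Metric.mem_ball_self hδ⟩ ⟨τ, hτ⟩)
  rw [hMτ0] at h4
  exact h3.trans h4

/-- Continuity of the Abel type transform in the turning radius. -/
lemma abel_cont {R : ℝ} (hR0 : 0 < R) {ρ w : ℝ → ℝ} (hρ : Continuous ρ) (hw : Continuous w)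
    {k : ℝ} (hk0 : 0 < k) (hρ0 : ∀ s ∈ Icc R 1, 0 < ρ s)
    (hk : ∀ s ∈ Icc R 1, ∀ t ∈ Icc R 1, s ≤ t → k * (t - s) ≤ ρ t - ρ s)
    {r0 : ℝ} (hr0 : r0 ∈ Ioo R 1) :
    ContinuousAt (fun r => ∫ s, (Ioc R 1).indicator
      (fun s => w s * (√(ρ s ^ 2 - ρ r ^ 2))⁻¹) s) r0 := by
  have htrans : (fun r => ∫ s, (Ioc R 1).indicator
      (fun s => w s * (√(ρ s ^ 2 - ρ r ^ 2))⁻¹) s) = fun r => ∫ v, (Ioc R 1).indicator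
      (fun s => w s * (√(ρ s ^ 2 - ρ r ^ 2))⁻¹) (v + r) := by
    funext r
    rw [integral_add_right_eq_self]
  rw [htrans]
  obtain ⟨M, hM⟩ := isCompact_Icc.exists_bound_of_continuousOn (hw.continuousOn (s := Icc R 1))
  have hM0 : 0 ≤ M := (norm_nonneg _).trans (hM r0 ⟨hr0.1.le, hr0.2.le⟩)
  have hρR := hρ0 R ⟨le_rfl, (hr0.1.trans hr0.2).le⟩
  set q := k * ρ R with hq
  have hq0 : 0 < q := mul_pos hk0 hρR
  have hbI : Integrable ((Ioc 0 1).indicator fun v : ℝ => M * (√q)⁻¹ * (√|v - 0|)⁻¹) := by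
    have := (intble_inv_sqrt_abs 0 0 1).const_mul (M * (√q)⁻¹)
    rw [intervalIntegrable_iff_integrableOn_Ioc_of_le zero_le_one] at this
    exact this.integrable_indicator measurableSet_Ioc
  refine continuousAt_of_dominated (bound := (Ioc 0 1).indicator
    fun v : ℝ => M * (√q)⁻¹ * (√|v - 0|)⁻¹) ?_ ?_ hbI ?_
  · refine Eventually.of_forall fun r => Measurable.aestronglyMeasurable ?_
    have hm : Measurable ((Ioc R 1).indicator (fun s => w s * (√(ρ s ^ 2 - ρ r ^ 2))⁻¹)) := by
      refine Measurable.indicator ?_ measurableSet_Ioc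
      have := hw.measurable
      have := hρ.measurable
      fun_prop
    exact hm.comp (measurable_id.add_const r)
  · filter_upwards [Ioo_mem_nhds hr0.1 hr0.2] with r hr
    refine Eventually.of_forall fun v => ?_
    have hb0 : 0 ≤ (Ioc (0:ℝ) 1).indicator (fun v : ℝ => M * (√q)⁻¹ * (√|v - 0|)⁻¹) v :=
      indicator_nonneg (fun _ _ => by positivity) v
    have hrI : r ∈ Icc R 1 := ⟨hr.1.le, hr.2.le⟩
    by_cases hvr : v + r ∈ Ioc R 1
    · rw [indicator_of_mem hvr]
      have hvI : v + r ∈ Icc R 1 := ⟨hvr.1.le, hvr.2⟩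
      rcases le_or_gt v 0 with hv | hv
      · have h1 := hk (v + r) hvI r hrI (by linarith)
        have h2 : 0 ≤ k * (r - (v + r)) := mul_nonneg hk0.le (by linarith)
        have h3 := hρ0 _ hvI
        rw [Real.sqrt_eq_zero_of_nonpos (by nlinarith)]
        simpa using hb0
      · have hv1 : v ≤ 1 := by linarith [hvr.2, hr.1]
        rw [indicator_of_mem (show v ∈ Ioc (0:ℝ) 1 from ⟨hv, hv1⟩), norm_mul, mul_assoc]
        refine mul_le_mul (hM _ hvI) ?_ (norm_nonneg _) hM0
        rw [Real.norm_of_nonneg (by positivity), sub_zero, abs_of_pos hv, ← mul_inv,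
          ← Real.sqrt_mul hq0.le]
        have h1 := hk r hrI (v + r) hvI (by linarith)
        have h2 := hk R ⟨le_rfl, hr.1.le.trans hr.2.le⟩ r hrI hr.1.le
        have h4 : 0 ≤ k * (r - R) := mul_nonneg hk0.le (by linarith [hr.1])
        have h5 : q * v ≤ ρ (v + r) ^ 2 - ρ r ^ 2 := by
          have h6 : k * v ≤ ρ (v + r) - ρ r := by linarith
          have h7 : ρ R ≤ ρ (v + r) + ρ r := by
            linarith [hρ0 _ hvI]
          have := mul_le_mul h6 h7 hρR.le (le_trans (by positivity) h6)
          rw [hq]; nlinarith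
        have : 0 < √(q * v) := Real.sqrt_pos.2 (by positivity)
        gcongr
    · rw [indicator_of_notMem hvr, norm_zero]
      exact hb0
  · have hne : ∀ᵐ v : ℝ, v ≠ 1 - r0 ∧ v ≠ 0 ∧ v ≠ R - r0 := by
      have h : ∀ a : ℝ, ∀ᵐ v : ℝ, v ≠ a := fun a => by simp [ae_iff]
      exact (h _).and ((h _).and (h _))
    filter_upwards [hne] with v ⟨hv1, hv0, hvR⟩
    by_cases hvr : v + r0 ∈ Ioo R 1
    · have hev : (fun r => (v + r) ∈ Ioo R 1) =ᶠ[𝓝 r0] fun _ => True := by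
        have : ContinuousAt (fun r => v + r) r0 := by fun_prop
        filter_upwards [this.preimage_mem_nhds (Ioo_mem_nhds hvr.1 hvr.2)] with r hr
        exact eq_true hr
      have hcont : ContinuousAt (fun r => w (v + r) * (√(ρ (v + r) ^ 2 - ρ r ^ 2))⁻¹) r0 := by
        rcases lt_or_gt_of_ne hv0 with hv | hv
        · have : (fun r => w (v + r) * (√(ρ (v + r) ^ 2 - ρ r ^ 2))⁻¹) =ᶠ[𝓝 r0]
              fun _ => (0:ℝ) := by
            filter_upwards [hev, Ioo_mem_nhds hr0.1 hr0.2] with r hr hr'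
            have hr := of_eq_true hr
            have hvI : v + r ∈ Icc R 1 := ⟨hr.1.le, hr.2.le⟩
            have h1 := hk (v + r) hvI r ⟨hr'.1.le, hr'.2.le⟩ (by linarith)
            have h2 : 0 ≤ k * (r - (v + r)) := mul_nonneg hk0.le (by linarith)
            have h3 := hρ0 _ hvI
            rw [Real.sqrt_eq_zero_of_nonpos (by nlinarith)]
            simp
          exact continuousAt_const.congr this.symm
        · have hvI : v + r0 ∈ Icc R 1 := ⟨hvr.1.le, hvr.2.le⟩
          have h1 := hk r0 ⟨hr0.1.le, hr0.2.le⟩ (v + r0) hvI (by linarith)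
          have h2 : 0 < k * ((v + r0) - r0) := mul_pos hk0 (by linarith)
          have h3 := hρ0 r0 ⟨hr0.1.le, hr0.2.le⟩
          have h4 : 0 < √(ρ (v + r0) ^ 2 - ρ r0 ^ 2) := Real.sqrt_pos.2 (by nlinarith)
          refine ContinuousAt.mul (by fun_prop) (ContinuousAt.inv₀ (by fun_prop) h4.ne')
      refine hcont.congr ?_
      filter_upwards [hev] with r hr
      have hr := of_eq_true hr
      rw [indicator_of_mem (Ioo_subset_Ioc_self hr)]
    · have hout : v + r0 ∉ Icc R 1 := by
        intro h
        refine hvr ⟨lt_of_le_of_ne h.1 fun h' => hvR (by linarith),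
          lt_of_le_of_ne h.2 fun h' => hv1 (by linarith)⟩
      have : (fun r => (Ioc R 1).indicator (fun s => w s * (√(ρ s ^ 2 - ρ r ^ 2))⁻¹) (v + r))
          =ᶠ[𝓝 r0] fun _ => (0:ℝ) := by
        have hc : ContinuousAt (fun r => v + r) r0 := by fun_prop
        filter_upwards [hc.preimage_mem_nhds (isClosed_Icc.isOpen_compl.mem_nhds hout)] with r hr
        exact indicator_of_notMem (fun h => hr (Ioc_subset_Icc_self h)) _
      exact continuousAt_const.congr this.symm

/-- Injectivity of the Abel type transform. -/
lemma abel_inj {R : ℝ} (hR0 : 0 < R) (hR1 : R < 1) {ρ w : ℝ → ℝ} (hρ : Continuous ρ)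
    (hw : Continuous w)
    {k : ℝ} (hk0 : 0 < k) (hρ0 : ∀ s ∈ Icc R 1, 0 < ρ s)
    (hk : ∀ s ∈ Icc R 1, ∀ t ∈ Icc R 1, s ≤ t → k * (t - s) ≤ ρ t - ρ s)
    (hzero : ∀ r ∈ Ioo R 1, ∫ s in Ioc R 1, w s * (√(ρ s ^ 2 - ρ r ^ 2))⁻¹ = 0) :
    ∀ r ∈ Ioo R 1, w r = 0 := by
  have hmono : ∀ s ∈ Icc R 1, ∀ t ∈ Icc R 1, s < t → ρ s < ρ t := by
    intro s hs t ht hst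
    have := hk s hs t ht hst.le
    have h2 : 0 < k * (t - s) := mul_pos hk0 (by linarith)
    linarith
  have hC := betaK_integral_pos
  have hwI : IntegrableOn w (Ioc R 1) :=
    (hw.continuousOn.integrableOn_Icc).mono_set Ioc_subset_Icc_self
  have hmain : ∀ y ∈ Ioo R 1, ∫ s in y..1, w s = 0 := by
    intro y hy
    have hyI : y ∈ Icc R 1 := ⟨hy.1.le, hy.2.le⟩
    let f : ℝ → ℝ → ℝ := fun s x => w s * ((√(x - ρ y ^ 2))⁻¹ * (√(ρ s ^ 2 - x))⁻¹)
    have hfI : Integrable (Function.uncurry f) ((volume.restrict (Ioc R 1)).prod volume) := by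
      rw [integrable_prod_iff]
      · refine ⟨Eventually.of_forall fun s =>
          (abelK_integrable (ρ y ^ 2) (ρ s ^ 2)).const_mul (w s), ?_⟩
        have hb : Integrable (fun s => |w s| * ∫ t, betaK t) (volume.restrict (Ioc R 1)) :=
          hwI.abs.mul_const _
        refine Integrable.mono' hb ?_ ?_
        · refine (StronglyMeasurable.integral_prod_right' (f := fun p : ℝ × ℝ =>
            ‖Function.uncurry f p‖) ?_).aestronglyMeasurable
          have := hw.measurable
          have := hρ.measurable
          refine (Measurable.norm ?_).stronglyMeasurable
          simp only [f, Function.uncurry_def]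
          fun_prop
        · refine Eventually.of_forall fun s => ?_
          have : ∀ x, ‖Function.uncurry f (s, x)‖
              = |w s| * ((√(x - ρ y ^ 2))⁻¹ * (√(ρ s ^ 2 - x))⁻¹) := by
            intro x
            simp only [f, Function.uncurry_apply_pair]
            rw [norm_mul, Real.norm_eq_abs, Real.norm_of_nonneg (by positivity)]
          simp_rw [this]
          rw [integral_const_mul, abelK_integral, norm_mul, norm_abs_eq_norm, Real.norm_eq_abs]
          gcongr
          split_ifs
          · rw [Real.norm_of_nonneg hC.le]
          · simpa using hC.le
      · have := hw.measurable
        have := hρ.measurable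
        refine Measurable.aestronglyMeasurable ?_
        simp only [f, Function.uncurry_def]
        fun_prop
    have hswap := integral_integral_swap hfI
    have hright : ∫ x, ∫ s in Ioc R 1, f s x = 0 := by
      rw [← integral_zero ℝ ℝ (μ := volume)]
      congr 1; funext x
      have e : ∀ s, f s x = (√(x - ρ y ^ 2))⁻¹ * (w s * (√(ρ s ^ 2 - x))⁻¹) := by
        intro s; simp only [f]; ring
      simp_rw [e]
      rw [integral_const_mul]
      rcases le_or_gt x (ρ y ^ 2) with hx | hx
      · rw [Real.sqrt_eq_zero_of_nonpos (by linarith)]; simp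
      · rcases le_or_gt (ρ 1 ^ 2) x with hx1 | hx1
        · have : ∫ s in Ioc R 1, w s * (√(ρ s ^ 2 - x))⁻¹ = ∫ s in Ioc R 1, (0:ℝ) := by
            refine setIntegral_congr_fun measurableSet_Ioc fun s hs => ?_
            have hsI : s ∈ Icc R 1 := ⟨hs.1.le, hs.2⟩
            have h1 := hk s hsI 1 ⟨hR1.le, le_rfl⟩ hs.2
            have h2 : 0 ≤ k * (1 - s) := mul_nonneg hk0.le (by linarith [hs.2])
            have h3 := hρ0 s hsI
            rw [Real.sqrt_eq_zero_of_nonpos (by nlinarith)]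
            simp
          rw [this]; simp
        · obtain ⟨r, hr, hrx⟩ := intermediate_value_Ioo hy.2.le
            ((hρ.pow 2).continuousOn (s := Icc y 1)) (show x ∈ Ioo (ρ y ^ 2) (ρ 1 ^ 2)
              from ⟨hx, hx1⟩)
          rw [Pi.pow_apply] at hrx
          rw [← hrx, hzero r ⟨hy.1.trans hr.1, hr.2⟩, mul_zero]
    have hleft : ∀ s ∈ Ioc R 1, ∫ x, f s x
        = (Ioc y 1).indicator (fun s => w s * ∫ t, betaK t) s := by
      intro s hs
      have hsI : s ∈ Icc R 1 := ⟨hs.1.le, hs.2⟩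
      simp only [f]
      rw [integral_const_mul, abelK_integral]
      rcases le_or_gt s y with h | h
      · rw [indicator_of_notMem (fun h' => absurd h'.1 (not_lt.2 h)), if_neg, mul_zero]
        have h1 := hk s hsI y hyI h
        have h2 : 0 ≤ k * (y - s) := mul_nonneg hk0.le (by linarith)
        have h3 := hρ0 s hsI
        nlinarith
      · rw [indicator_of_mem (show s ∈ Ioc y 1 from ⟨h, hs.2⟩), if_pos]
        have h1 := hmono y hyI s hsI h
        have h3 := hρ0 y hyI
        nlinarith
    rw [hright, setIntegral_congr_fun measurableSet_Ioc hleft,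
      setIntegral_indicator measurableSet_Ioc,
      inter_eq_self_of_subset_right (Ioc_subset_Ioc_left hy.1.le), integral_mul_const] at hswap
    rw [intervalIntegral.integral_of_le hy.2.le]
    exact (mul_eq_zero.1 hswap).resolve_right hC.ne'
  intro r hr
  have hd : HasDerivAt (fun y => ∫ s in y..1, w s) (-w r) r :=
    intervalIntegral.integral_hasDerivAt_left (hw.intervalIntegrable _ _)
      hw.stronglyMeasurable.stronglyMeasurableAtFilter hw.continuousAt
  have hd0 : HasDerivAt (fun y => ∫ s in y..1, w s) 0 r := by
    refine (hasDerivAt_const r (0:ℝ)).congr_of_eventuallyEq ?_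
    filter_upwards [Ioo_mem_nhds hr.1 hr.2] with y hy
    exact hmain y hy
  have := hd.unique hd0
  linarith

lemma get_nm {x y : ℝ} (hx : 0 ≤ x) (hxy : x < y) : ∃ n m : ℕ, 0 < n ∧ 0 < m ∧
    Nat.Coprime n m ∧ (n : ℝ) * x < m * Real.pi ∧ (m : ℝ) * Real.pi < n * y := by
  have hpi := Real.pi_pos
  obtain ⟨q, hq1, hq2⟩ := exists_rat_btwn (div_lt_div_of_pos_right hxy hpi)
  have hq0 : 0 < q := by
    have : (0:ℝ) < q := lt_of_le_of_lt (by positivity) hq1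
    exact_mod_cast this
  have hnum : 0 < q.num := Rat.num_pos.2 hq0
  have hden : (0:ℝ) < q.den := by exact_mod_cast q.den_pos
  have hnat : ((q.num.natAbs : ℕ) : ℝ) = (q.num : ℝ) := by
    rw [Nat.cast_natAbs, abs_of_pos hnum]
  have hqe : (q : ℝ) = q.num.natAbs / q.den := by
    rw [hnat]; exact Rat.cast_def q
  refine ⟨q.den, q.num.natAbs, q.den_pos, Int.natAbs_pos.2 hnum.ne', q.reduced.symm, ?_, ?_⟩
  · rw [hqe, div_lt_div_iff₀ hpi hden] at hq1
    linarith
  · rw [hqe, div_lt_div_iff₀ hden hpi] at hq2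
    linarith

section family
variable {R : ℝ} (hR0 : 0 < R) (hR1 : R < 1) {ε : ℝ}
    {c : ℝ → ℝ → ℝ} {cdot : ℝ → ℝ → ℝ}
    (hpos : ∀ τ ∈ Set.Ioo (-ε) ε, ∀ r ∈ Set.Icc R 1, 0 < c τ r)
    (hcont : ContinuousOn (fun p : ℝ × ℝ => c p.1 p.2) (Set.Ioo (-ε) ε ×ˢ Set.Icc R 1))

include hR0 hR1 hpos hcont

lemma F_joint_cont :
    ContinuousOn (fun p : ℝ × ℝ => Ffun (c p.1) R p.2) (Ioo (-ε) ε ×ˢ univ) := by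
  rw [continuousOn_iff_continuous_domRestrict]
  let pr : ℝ → ℝ := fun s => (projIcc R 1 hR1.le s : ℝ)
  have hpr : Continuous pr := continuous_subtype_val.comp continuous_projIcc
  have hprm : ∀ s, pr s ∈ Icc R 1 := fun s => (projIcc R 1 hR1.le s).2
  have hC : Continuous (fun q : (Ioo (-ε) ε ×ˢ (univ : Set ℝ) : Set (ℝ × ℝ)) × ℝ =>
      c q.1.1.1 (pr q.2)) := by
    have : Continuous ((fun p : ℝ × ℝ => c p.1 p.2) ∘
        fun q : (Ioo (-ε) ε ×ˢ (univ : Set ℝ) : Set (ℝ × ℝ)) × ℝ => (q.1.1.1, pr q.2)) := by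
      rw [← continuousOn_univ]
      refine hcont.comp (by fun_prop) ?_
      intro q _
      exact ⟨q.1.2.1, hprm _⟩
    exact this
  have hf : Continuous (Function.uncurry
      fun (p : (Ioo (-ε) ε ×ˢ (univ : Set ℝ) : Set (ℝ × ℝ))) (s : ℝ) =>
      √(1 / (c p.1.1 (pr s)) ^ 2 - p.1.2 ^ 2 / (pr s) ^ 2)) := by
    simp only [Function.uncurry_def]
    refine Continuous.sqrt (Continuous.sub ?_ ?_)
    · exact continuous_const.div (hC.pow 2) fun q =>
        (pow_pos (hpos _ q.1.2.1 _ (hprm _)) 2).ne'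
    · refine Continuous.div (by fun_prop) (by fun_prop) fun q => ?_
      exact (pow_pos (hR0.trans_le (hprm _).1) 2).ne'
  have := intervalIntegral.continuous_parametric_intervalIntegral_of_continuous' (μ := volume)
    hf R 1
  refine this.congr fun p => ?_
  simp only [domRestrict_apply, Ffun]
  refine intervalIntegral.integral_congr fun s hs => ?_
  rw [uIcc_of_le hR1.le] at hs
  have : pr s = s := by simp only [pr]; rw [projIcc_of_mem hR1.le hs]
  simp only [this]

variable (hdtau : ∀ τ ∈ Set.Ioo (-ε) ε, ∀ r ∈ Set.Icc R 1,
      HasDerivWithinAt (fun t => c t r) (cdot τ r) (Set.Ioo (-ε) ε) τ)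
    (hdcont : ContinuousOn (fun p : ℝ × ℝ => cdot p.1 p.2)
      (Set.Ioo (-ε) ε ×ˢ Set.Icc R 1))

lemma c_cont {τ : ℝ} (hτ : τ ∈ Ioo (-ε) ε) : ContinuousOn (c τ) (Icc R 1) := by
  have : ContinuousOn ((fun p : ℝ × ℝ => c p.1 p.2) ∘ fun s => (τ, s)) (Icc R 1) :=
    hcont.comp (by fun_prop) fun s hs => ⟨hτ, hs⟩
  exact this

include hdtau hdcont

lemma cdot_cont {τ : ℝ} (hτ : τ ∈ Ioo (-ε) ε) : ContinuousOn (cdot τ) (Icc R 1) := by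
  have : ContinuousOn ((fun p : ℝ × ℝ => cdot p.1 p.2) ∘ fun s => (τ, s)) (Icc R 1) :=
    hdcont.comp (by fun_prop) fun s hs => ⟨hτ, hs⟩
  exact this

lemma c_tau_deriv {τ : ℝ} (hτ : τ ∈ Ioo (-ε) ε) {s : ℝ} (hs : s ∈ Icc R 1) :
    HasDerivAt (fun t => c t s) (cdot τ s) τ :=
  (hdtau τ hτ s hs).hasDerivAt (Ioo_mem_nhds hτ.1 hτ.2)

lemma g_tau_deriv {τ : ℝ} (hτ : τ ∈ Ioo (-ε) ε) {s : ℝ} (hs : s ∈ Icc R 1) (z : ℝ) :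
    HasDerivAt (fun t => 1 / (c t s) ^ 2 - z ^ 2 / s ^ 2) (-(2 * cdot τ s / c τ s ^ 3)) τ := by
  have hc := hpos τ hτ s hs
  have h1 := (((c_tau_deriv hR0 hR1 hpos hcont hdtau hdcont hτ hs).pow 2).inv
    (pow_pos hc 2).ne').sub_const (z ^ 2 / s ^ 2)
  have h2 : (fun t => 1 / (c t s) ^ 2 - z ^ 2 / s ^ 2)
      = fun t => (((fun t => c t s) ^ 2)⁻¹ : ℝ → ℝ) t - z ^ 2 / s ^ 2 := by
    funext t; simp
  rw [h2]
  refine h1.congr_deriv ?_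
  simp
  field_simp

lemma F_tau_deriv {τ0 : ℝ} (hτ0 : τ0 ∈ Ioo (-ε) ε) {k : ℝ} (hk0 : 0 < k)
    (hk : ∀ s ∈ Icc R 1, ∀ t ∈ Icc R 1, s ≤ t → k * (t - s) ≤ t / c τ0 t - s / c τ0 s)
    {z : ℝ} (hz : 0 < z) (hz1 : z < 1 / c τ0 1) :
    HasDerivAt (fun τ => Ffun (c τ) R z)
      (∫ s in R..1, -(2 * cdot τ0 s / c τ0 s ^ 3) / 2 *
        (√(1 / (c τ0 s) ^ 2 - z ^ 2 / s ^ 2))⁻¹) τ0 := by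
  have hcc := fun τ (hτ : τ ∈ Ioo (-ε) ε) => c_cont hR0 hR1 hpos hcont hτ
  obtain ⟨r0, hr0⟩ := g_low hR0 hR1 (hpos τ0 hτ0) (hcc τ0 hτ0) hk0 hk hz hz1
  obtain ⟨δ, hδ, hball⟩ := Metric.nhds_basis_closedBall.mem_iff.1 (Ioo_mem_nhds hτ0.1 hτ0.2)
  have hcomp : IsCompact (Metric.closedBall τ0 δ ×ˢ Icc R 1) :=
    (isCompact_closedBall τ0 δ).prod isCompact_Icc
  have hsub : Metric.closedBall τ0 δ ×ˢ Icc R 1 ⊆ Ioo (-ε) ε ×ˢ Icc R 1 :=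
    prod_mono hball subset_rfl
  have hdc : ContinuousOn (fun p : ℝ × ℝ => -(2 * cdot p.1 p.2 / c p.1 p.2 ^ 3))
      (Metric.closedBall τ0 δ ×ˢ Icc R 1) := by
    refine ContinuousOn.neg (ContinuousOn.div (continuousOn_const.mul (hdcont.mono hsub))
      ((hcont.mono hsub).pow 3) ?_)
    intro p hp
    exact (pow_pos (hpos p.1 (hsub hp).1 p.2 (hsub hp).2) 3).ne'
  obtain ⟨C, hC⟩ := hcomp.exists_bound_of_continuousOn hdc
  refine hasDerivAt_int_sqrt hR1 (g := fun τ s => 1 / (c τ s) ^ 2 - z ^ 2 / s ^ 2)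
    (g' := fun s => -(2 * cdot τ0 s / c τ0 s ^ 3)) (C := C) (r0 := r0) (k := k * z)
    (by positivity) ?_ ?_ ?_ hr0
  · filter_upwards [Ioo_mem_nhds hτ0.1 hτ0.2] with τ hτ
    exact cont_g hR0 (hpos τ hτ) (hcc τ hτ) z
  · filter_upwards [Metric.closedBall_mem_nhds τ0 hδ] with τ hτ s hs
    have := (convex_closedBall τ0 δ).norm_image_sub_le_of_norm_hasDerivWithin_le
      (f := fun t => 1 / (c t s) ^ 2 - z ^ 2 / s ^ 2)
      (f' := fun t => -(2 * cdot t s / c t s ^ 3)) (C := C)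
      (fun t ht => (g_tau_deriv hR0 hR1 hpos hcont hdtau hdcont (hball ht) hs z).hasDerivWithinAt)
      (fun t ht => hC (t, s) ⟨ht, hs⟩) (Metric.mem_closedBall_self hδ.le) hτ
    simpa [Real.norm_eq_abs] using this
  · intro s hs
    exact g_tau_deriv hR0 hR1 hpos hcont hdtau hdcont hτ0 hs z

variable (hkk : ∀ τ ∈ Ioo (-ε) ε, ∃ k > 0, ∀ s ∈ Icc R 1, ∀ t ∈ Icc R 1, s ≤ t →
      k * (t - s) ≤ t / c τ t - s / c τ s)
    (hccc : ∀ τ ∈ Set.Ioo (-ε) ε,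
      {r | r ∈ Set.Ioo R 1 ∧ deriv (alphaFun (c τ)) r = 0}.Countable)
    (hlsp : ∀ τ ∈ Set.Ioo (-ε) ε, lsp' (c τ) R = lsp' (c 0) R)
include hkk hccc hlsp

lemma dense_zero {τ0 : ℝ} (hτ0 : τ0 ∈ Ioo (-ε) ε) {a b : ℝ} (hab : a < b) (ha : R ≤ a)
    (hb : b ≤ 1) : ∃ r ∈ Ioo a b, ∫ s in R..1, -(2 * cdot τ0 s / c τ0 s ^ 3) / 2 *
        (√(1 / (c τ0 s) ^ 2 - (r / c τ0 r) ^ 2 / s ^ 2))⁻¹ = 0 := by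
  have hcc := fun τ (hτ : τ ∈ Ioo (-ε) ε) => c_cont hR0 hR1 hpos hcont hτ
  obtain ⟨k, hk0, hk⟩ := hkk τ0 hτ0
  have hp0 := hpos τ0 hτ0
  have hc0 := hcc τ0 hτ0
  have hIoo : Ioo a b ⊆ Ioo R 1 := Ioo_subset_Ioo ha hb
  -- two radii with different angles
  have hne : ∃ r1 ∈ Ioo a b, ∃ r2 ∈ Ioo a b, r1 < r2 ∧
      alphaFun (c τ0) r1 ≠ alphaFun (c τ0) r2 := by
    by_contra hcon
    push Not at hcon
    have hcst : ∀ x ∈ Ioo a b, ∀ y ∈ Ioo a b, alphaFun (c τ0) x = alphaFun (c τ0) y := by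
      intro x hx y hy
      rcases lt_trichotomy x y with h | h | h
      · exact hcon x hx y hy h
      · rw [h]
      · exact (hcon y hy x hx h).symm
    have hcount : (Ioo a b).Countable := by
      refine Set.Countable.mono ?_ (hccc τ0 hτ0)
      intro r hr
      refine ⟨hIoo hr, ?_⟩
      have : alphaFun (c τ0) =ᶠ[𝓝 r] fun _ => alphaFun (c τ0) r := by
        filter_upwards [Ioo_mem_nhds hr.1 hr.2] with x hx
        exact hcst x hx r hr
      rw [this.deriv_eq]; simp
    have h0 := hcount.measure_zero volume
    rw [Real.volume_Ioo, ENNReal.ofReal_eq_zero] at h0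
    linarith
  obtain ⟨r1, hr1, r2, hr2, hr12, hα⟩ := hne
  have hr1I : r1 ∈ Icc R 1 := Ioo_subset_Icc_self (hIoo hr1)
  have hr2I : r2 ∈ Icc R 1 := Ioo_subset_Icc_self (hIoo hr2)
  rw [alpha_eq hR0 hR1 hp0 hc0 hk0 hk (hIoo hr1), alpha_eq hR0 hR1 hp0 hc0 hk0 hk (hIoo hr2)] at hα
  obtain ⟨hz1p, hz1l⟩ := rho_mem hR0 hR1 hp0 hc0 hk0 hk (hIoo hr1)
  obtain ⟨hz2p, hz2l⟩ := rho_mem hR0 hR1 hp0 hc0 hk0 hk (hIoo hr2)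
  have hz1R : R / c τ0 R < r1 / c τ0 r1 := by
    have := hk R ⟨le_rfl, hR1.le⟩ r1 hr1I hr1I.1
    have h2 : 0 < k * (r1 - R) := mul_pos hk0 (by linarith [hr1.1])
    linarith
  have hz12 : r1 / c τ0 r1 < r2 / c τ0 r2 := by
    have := hk r1 hr1I r2 hr2I hr12.le
    have h2 : 0 < k * (r2 - r1) := mul_pos hk0 (by linarith)
    linarith
  have hA0 : ∀ z, 0 < z → 0 ≤ Afun (c τ0) R z := by
    intro z hz
    unfold Afun
    exact intervalIntegral.integral_nonneg hR1.le fun s _ => by positivity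
  have hnull : volume (lsp' (c 0) R) = 0 := by
    rw [← hlsp τ0 hτ0]; exact lsp_null hR0 hR1 hp0 hc0 hk0 hk
  -- eventual critical values
  have hcrit : ∀ n m : ℕ, 0 < n → 0 < m → Nat.Coprime n m → ∀ᶠ τ in 𝓝 τ0,
      ∀ z ∈ Ioo (r1 / c τ0 r1) (r2 / c τ0 r2),
      IsLocalExtr (fun z => 2 * (n * Ffun (c τ) R z + m * Real.pi * z)) z →
      2 * (n * Ffun (c τ) R z + m * Real.pi * z) ∈ lsp' (c 0) R := by
    intro n m hn hm hco
    have hct : ∀ s ∈ Icc R 1, ContinuousAt (fun τ => s / c τ s) τ0 := fun s hs =>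
      continuousAt_const.div
        (c_tau_deriv hR0 hR1 hpos hcont hdtau hdcont hτ0 hs).continuousAt (hp0 s hs).ne'
    filter_upwards [Ioo_mem_nhds hτ0.1 hτ0.2,
      (hct R ⟨le_rfl, hR1.le⟩).eventually (gt_mem_nhds hz1R),
      (hct 1 ⟨hR1.le, le_rfl⟩).eventually (lt_mem_nhds hz2l)] with τ hτ h1 h2 z hz hext
    obtain ⟨k', hk0', hk'⟩ := hkk τ hτ
    rw [← hlsp τ hτ]
    exact crit_mem hR0 hR1 (hpos τ hτ) (hcc τ hτ) hk0' hk' (h1.trans hz.1) (hz.2.trans h2)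
      hn hm hco hext
  have hFj := F_joint_cont hR0 hR1 hpos hcont
  have hGj : ∀ n m : ℕ, ContinuousOn (fun p : ℝ × ℝ =>
      2 * (n * Ffun (c p.1) R p.2 + m * Real.pi * p.2)) (Ioo (-ε) ε ×ˢ univ) := by
    intro n m
    exact continuousOn_const.mul ((continuousOn_const.mul hFj).add (by fun_prop))
  -- a stationary point in `τ`
  have hstat : ∃ n : ℕ, 0 < n ∧ ∃ m : ℕ, ∃ z ∈ Ioo (r1 / c τ0 r1) (r2 / c τ0 r2),
      IsLocalExtr (fun τ => 2 * (n * Ffun (c τ) R z + m * Real.pi * z)) τ0 := by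
    rcases lt_or_gt_of_ne hα with h | h
    · obtain ⟨n, m, hn, hm, hco, e1, e2⟩ := get_nm (hA0 _ hz1p) h
      obtain ⟨z, hz, hev⟩ := persist isOpen_Ioo hτ0 (G := fun τ z =>
        2 * (n * Ffun (c τ) R z + m * Real.pi * z)) (hGj n m) hz12
        (Phi_deriv hR0 hR1 hp0 hc0 hk0 hk hz1p hz1l n m) (by linarith)
        (Phi_deriv hR0 hR1 hp0 hc0 hk0 hk hz2p hz2l n m) (by linarith) hnull
        ((hcrit n m hn hm hco).mono fun τ hτ z hz hmax => hτ z hz (Or.inr hmax))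
      exact ⟨n, hn, m, z, hz, Or.inr hev⟩
    · obtain ⟨n, m, hn, hm, hco, e1, e2⟩ := get_nm (hA0 _ hz2p) h
      have hnull' : volume (Neg.neg ⁻¹' (lsp' (c 0) R)) = 0 := by
        rw [Measure.measure_preimage_neg]; exact hnull
      obtain ⟨z, hz, hev⟩ := persist isOpen_Ioo hτ0 (G := fun τ z =>
        -(2 * (n * Ffun (c τ) R z + m * Real.pi * z))) (hGj n m).neg hz12
        (Phi_deriv hR0 hR1 hp0 hc0 hk0 hk hz1p hz1l n m).neg (by linarith)
        (Phi_deriv hR0 hR1 hp0 hc0 hk0 hk hz2p hz2l n m).neg (by linarith) hnull'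
        ((hcrit n m hn hm hco).mono fun τ hτ z hz hmax => by
          rw [mem_preimage, neg_neg]
          refine hτ z hz (Or.inl ?_)
          filter_upwards [hmax] with x hx
          exact neg_le_neg_iff.1 hx)
      refine ⟨n, hn, m, z, hz, Or.inl ?_⟩
      filter_upwards [hev] with τ hτ
      exact neg_le_neg_iff.1 hτ
  obtain ⟨n, hn, m, z, hz, hext⟩ := hstat
  have hd := F_tau_deriv hR0 hR1 hpos hcont hdtau hdcont hτ0 hk0 hk (hz1p.trans hz.1)
    (hz.2.trans hz2l)
  have hd2 := ((hd.const_mul (n : ℝ)).add_const (m * Real.pi * z)).const_mul 2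
  have h0 := hext.hasDerivAt_eq_zero hd2
  have hn' : (n : ℝ) ≠ 0 := by exact_mod_cast hn.ne'
  obtain ⟨r, hr, hrz⟩ := intermediate_value_Ioo hr12.le
    ((cont_rho hp0 hc0).mono (Icc_subset_Icc hr1I.1 hr2I.2)) hz
  refine ⟨r, ⟨hr1.1.trans hr.1, hr.2.trans hr2.2⟩, ?_⟩
  simp only at hrz
  rw [hrz]
  simpa [hn'] using h0

lemma cdot_zero {τ0 : ℝ} (hτ0 : τ0 ∈ Ioo (-ε) ε) : ∀ r ∈ Ioo R 1, cdot τ0 r = 0 := by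
  have hc0 := c_cont hR0 hR1 hpos hcont hτ0
  have hcd := cdot_cont hR0 hR1 hpos hcont hdtau hdcont hτ0
  obtain ⟨k, hk0, hk⟩ := hkk τ0 hτ0
  have hp0 := hpos τ0 hτ0
  have hwc : ContinuousOn (fun s => -(cdot τ0 s / c τ0 s ^ 3) * s) (Icc R 1) :=
    ((hcd.div (hc0.pow 3) fun s hs => (pow_pos (hp0 s hs) 3).ne').neg).mul continuousOn_id
  set ρ : ℝ → ℝ := IccExtend hR1.le ((Icc R 1).domRestrict fun s => s / c τ0 s) with hρdef
  set w : ℝ → ℝ := IccExtend hR1.le ((Icc R 1).domRestrict fun s =>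
    -(cdot τ0 s / c τ0 s ^ 3) * s) with hwdef
  have hρe : ∀ s ∈ Icc R 1, ρ s = s / c τ0 s := fun s hs => by
    rw [hρdef, IccExtend_of_mem _ _ hs]; rfl
  have hwe : ∀ s ∈ Icc R 1, w s = -(cdot τ0 s / c τ0 s ^ 3) * s := fun s hs => by
    rw [hwdef, IccExtend_of_mem _ _ hs]; rfl
  have hρc : Continuous ρ :=
    (continuousOn_iff_continuous_domRestrict.1 (cont_rho hp0 hc0)).Icc_extend'
  have hwcc : Continuous w :=
    (continuousOn_iff_continuous_domRestrict.1 hwc).Icc_extend'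
  have hρ0 : ∀ s ∈ Icc R 1, 0 < ρ s := fun s hs => by
    rw [hρe s hs]; exact div_pos (hR0.trans_le hs.1) (hp0 s hs)
  have hρk : ∀ s ∈ Icc R 1, ∀ t ∈ Icc R 1, s ≤ t → k * (t - s) ≤ ρ t - ρ s := by
    intro s hs t ht hst
    rw [hρe s hs, hρe t ht]; exact hk s hs t ht hst
  have hDe : ∀ r ∈ Ioo R 1, ∫ s in R..1, -(2 * cdot τ0 s / c τ0 s ^ 3) / 2 *
        (√(1 / (c τ0 s) ^ 2 - (r / c τ0 r) ^ 2 / s ^ 2))⁻¹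
      = ∫ s in Ioc R 1, w s * (√(ρ s ^ 2 - ρ r ^ 2))⁻¹ := by
    intro r hr
    rw [intervalIntegral.integral_of_le hR1.le]
    refine setIntegral_congr_fun measurableSet_Ioc fun s hs => ?_
    have hsI : s ∈ Icc R 1 := Ioc_subset_Icc_self hs
    have hs0 : 0 < s := hR0.trans_le hsI.1
    have hc := hp0 s hsI
    rw [hρe s hsI, hwe s hsI, hρe r (Ioo_subset_Icc_self hr)]
    have e : 1 / (c τ0 s) ^ 2 - (r / c τ0 r) ^ 2 / s ^ 2
        = ((s / c τ0 s) ^ 2 - (r / c τ0 r) ^ 2) / s ^ 2 := by field_simp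
    rw [e, Real.sqrt_div' _ (by positivity), Real.sqrt_sq hs0.le, inv_div]
    ring
  have hzero : ∀ r ∈ Ioo R 1, ∫ s in Ioc R 1, w s * (√(ρ s ^ 2 - ρ r ^ 2))⁻¹ = 0 := by
    intro r0 hr0
    have hca := abel_cont hR0 hρc hwcc hk0 hρ0 hρk hr0
    simp_rw [integral_indicator measurableSet_Ioc] at hca
    by_contra hne
    have hev := hca.eventually_ne hne
    obtain ⟨a, b, hmem, hsub⟩ := mem_nhds_iff_exists_Ioo_subset.1
      (hev.and (Ioo_mem_nhds hr0.1 hr0.2))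
    have hab : max a R < min b 1 := by
      rw [max_lt_iff, lt_min_iff, lt_min_iff]
      exact ⟨⟨hmem.1.trans hmem.2, hmem.1.trans hr0.2⟩, ⟨hr0.1.trans hmem.2, hR1⟩⟩
    obtain ⟨r, hr, hr0⟩ := dense_zero hR0 hR1 hpos hcont hdtau hdcont hkk hccc hlsp hτ0 hab
      (le_max_right _ _) (min_le_right _ _)
    have h1 := hsub (show r ∈ Ioo a b from
      ⟨(le_max_left _ _).trans_lt hr.1, hr.2.trans_le (min_le_left _ _)⟩)
    exact h1.1 ((hDe r h1.2).symm.trans hr0)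
  intro r hr
  have h := abel_inj hR0 hR1 hρc hwcc hk0 hρ0 hρk hzero r hr
  have hrI := Ioo_subset_Icc_self hr
  rw [hwe r hrI] at h
  have hr0 : r ≠ 0 := (hR0.trans hr.1).ne'
  have hc : c τ0 r ≠ 0 := (hp0 r hrI).ne'
  simpa [hr0, hc] using h

end family

theorem stmt12 (R : ℝ) (hR0 : 0 < R) (hR1 : R < 1) (ε : ℝ) (hε : 0 < ε)
    (c : ℝ → ℝ → ℝ) (cdot : ℝ → ℝ → ℝ)
    (hpos : ∀ τ ∈ Set.Ioo (-ε) ε, ∀ r ∈ Set.Icc R 1, 0 < c τ r)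
    (hC11 : ∀ τ ∈ Set.Ioo (-ε) ε, IsC11On (c τ) R)
    (hHerg : ∀ τ ∈ Set.Ioo (-ε) ε, HerglotzCond (c τ) R)
    (hccc : ∀ τ ∈ Set.Ioo (-ε) ε,
      {r | r ∈ Set.Ioo R 1 ∧ deriv (alphaFun (c τ)) r = 0}.Countable)
    (hcont : ContinuousOn (fun p : ℝ × ℝ => c p.1 p.2) (Set.Ioo (-ε) ε ×ˢ Set.Icc R 1))
    (hdtau : ∀ τ ∈ Set.Ioo (-ε) ε, ∀ r ∈ Set.Icc R 1,
      HasDerivWithinAt (fun t => c t r) (cdot τ r) (Set.Ioo (-ε) ε) τ)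
    (hdcont : ContinuousOn (fun p : ℝ × ℝ => cdot p.1 p.2)
      (Set.Ioo (-ε) ε ×ˢ Set.Icc R 1))
    (hlsp : ∀ τ ∈ Set.Ioo (-ε) ε, lsp' (c τ) R = lsp' (c 0) R) :
    ∀ τ ∈ Set.Ioo (-ε) ε, ∀ r ∈ Set.Icc R 1, c τ r = c 0 r := by
  have hkk : ∀ τ ∈ Set.Ioo (-ε) ε, ∃ k > 0, ∀ s ∈ Set.Icc R 1, ∀ t ∈ Set.Icc R 1, s ≤ t →
      k * (t - s) ≤ t / c τ t - s / c τ s := fun τ hτ =>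
    herglotz_lower hR0 hR1 (hpos τ hτ) (hC11 τ hτ) (hHerg τ hτ)
  have h0 : (0:ℝ) ∈ Set.Ioo (-ε) ε := ⟨by linarith, hε⟩
  have hint : ∀ τ ∈ Set.Ioo (-ε) ε, ∀ r ∈ Set.Ioo R 1, c τ r = c 0 r := by
    intro τ hτ r hr
    have hrI := Set.Ioo_subset_Icc_self hr
    have := (convex_Ioo (-ε) ε).norm_image_sub_le_of_norm_hasDerivWithin_le
      (f := fun t => c t r) (f' := fun t => cdot t r) (C := 0)
      (fun t ht => hdtau t ht r hrI)
      (fun t ht => by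
        rw [cdot_zero hR0 hR1 hpos hcont hdtau hdcont hkk hccc hlsp ht r hr]; simp) h0 hτ
    rw [zero_mul, norm_le_zero_iff, sub_eq_zero] at this
    exact this
  intro τ hτ r hr
  have hc1 := c_cont hR0 hR1 hpos hcont hτ
  have hc2 := c_cont hR0 hR1 hpos hcont h0
  have hcl : Set.Icc R 1 ⊆ closure (Set.Ioo R 1) := by
    rw [closure_Ioo hR1.ne]
  exact Set.EqOn.of_subset_closure (fun x hx => hint τ hτ x hx) hc1 hc2
    Set.Ioo_subset_Icc_self hcl hr
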